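/- arXiv:2311.11541 — 4 statements merged into one kernel-verified Lean document; each statement's English description precedes it below -/
import Mathlib

section
/- Let p > 1 be a real number and n ≥ 1 an integer. For all vectors a, b ∈ ℝⁿ with a ≠ b, one has (|a|^{p−2}a − |b|^{p−2}b) · (a − b) ≥ (min{1, p−1} / 2^{p−2}) · (|a| + |b|)^{p−2} · |a − b|². -/
open scoped RealInnerProductSpace

theorem two_le_one_add_rpow_add_one_sub_rpow {v t : ℝ} (hv : v ≤ 0) (ht : 0 ≤ t) (ht1 : t < 1) :
    2 ≤ (1 + t) ^ v + (1 - t) ^ v := by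
  have hP : 0 < (1 + t) ^ v := Real.rpow_pos_of_pos (by linarith) _
  have hQ : 0 < (1 - t) ^ v := Real.rpow_pos_of_pos (by linarith) _
  have hPQ : 1 ≤ (1 + t) ^ v * (1 - t) ^ v := by
    rw [← Real.mul_rpow (by linarith) (by linarith)]
    exact Real.one_le_rpow_of_pos_of_le_one_of_nonpos
      (mul_pos (by linarith) (by linarith)) (by nlinarith) hv
  nlinarith [sq_nonneg ((1 + t) ^ v - (1 - t) ^ v)]

theorem two_mul_mul_le_one_add_rpow_sub_one_sub_rpow {u x : ℝ} (hu : 0 < u) (hu1 : u ≤ 1)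
    (hx : 0 ≤ x) (hx1 : x ≤ 1) : 2 * u * x ≤ (1 + x) ^ u - (1 - x) ^ u := by
  have hmono : MonotoneOn (fun t : ℝ => (1 + t) ^ u - (1 - t) ^ u - 2 * u * t)
      (Set.Icc 0 1) := by
    refine monotoneOn_of_hasDerivWithinAt_nonneg
      (f' := fun t => 1 * u * (1 + t) ^ (u - 1) - (-1) * u * (1 - t) ^ (u - 1) - 2 * u * 1)
      (convex_Icc 0 1) ?_ ?_ ?_
    · have h1 : Continuous fun t : ℝ => (1 + t) ^ u :=
        (continuous_const.add continuous_id).rpow_const fun _ => Or.inr hu.le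
      have h2 : Continuous fun t : ℝ => (1 - t) ^ u :=
        (continuous_const.sub continuous_id).rpow_const fun _ => Or.inr hu.le
      exact ((h1.sub h2).sub (continuous_const.mul continuous_id)).continuousOn
    · intro t ht
      rw [interior_Icc] at ht
      have h1 := ((hasDerivAt_id' t).const_add 1).rpow_const (p := u)
        (Or.inl (add_pos one_pos ht.1).ne')
      have h2 := ((hasDerivAt_id' t).const_sub 1).rpow_const (p := u)
        (Or.inl (sub_pos.2 ht.2).ne')
      exact ((h1.sub h2).sub ((hasDerivAt_id' t).const_mul (2 * u))).hasDerivWithinAt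
    · intro t ht
      rw [interior_Icc] at ht
      have h := two_le_one_add_rpow_add_one_sub_rpow (sub_nonpos.2 hu1) ht.1.le ht.2
      have := mul_le_mul_of_nonneg_left h hu.le
      linarith
  have h := hmono (Set.left_mem_Icc.2 zero_le_one) ⟨hx, hx1⟩ hx
  simp only [add_zero, sub_zero, Real.one_rpow, sub_self, mul_zero] at h
  linarith

theorem min_mul_le_one_add_rpow_sub_one_sub_rpow {u x : ℝ} (hu : 0 < u)
    (hx : 0 ≤ x) (hx1 : x ≤ 1) : min 1 u * (2 * x) ≤ (1 + x) ^ u - (1 - x) ^ u := by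
  rcases le_total u 1 with h | h
  · rw [min_eq_right h]
    linarith [two_mul_mul_le_one_add_rpow_sub_one_sub_rpow hu h hx hx1]
  · rw [min_eq_left h]
    have h1 : 1 + x ≤ (1 + x) ^ u := Real.self_le_rpow_of_one_le (by linarith) h
    have h2 : (1 - x) ^ u ≤ 1 - x :=
      Real.rpow_le_self_of_le_one (by linarith) (by linarith) h
    linarith

theorem min_mul_two_le_one_add_rpow_add_one_sub_rpow {u x : ℝ} (hu : 0 < u)
    (hx : 0 ≤ x) (hx1 : x ≤ 1) : min 1 u * 2 ≤ (1 + x) ^ u + (1 - x) ^ u := by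
  rcases le_total u 1 with h | h
  · rw [min_eq_right h]
    have key : ∀ y : ℝ, 0 ≤ y → y ≤ 2 → 2 ^ u * (y / 2) ≤ y ^ u := by
      intro y hy hy2
      calc (2 : ℝ) ^ u * (y / 2) ≤ 2 ^ u * (y / 2) ^ u := by
            gcongr
            exact Real.self_le_rpow_of_le_one (by linarith) (by linarith) h
        _ = y ^ u := by
            rw [← Real.mul_rpow (by norm_num) (by linarith)]
            congr 1
            ring
    have h1 := key (1 + x) (by linarith) (by linarith)
    have h2 := key (1 - x) (by linarith) (by linarith)
    have h3 := two_mul_mul_le_one_add_rpow_sub_one_sub_rpow hu h zero_le_one le_rfl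
    rw [sub_self, Real.zero_rpow hu.ne', one_add_one_eq_two] at h3
    linarith
  · rw [min_eq_left h]
    have h1 := one_add_mul_self_le_rpow_one_add (s := x) (by linarith) h
    have h2 := one_add_mul_self_le_rpow_one_add (s := -x) (by linarith) h
    rw [← sub_eq_add_neg] at h2
    linarith

theorem min_mul_rpow_mean_mul_le {u r s : ℝ} (hu : 0 < u) (hs : 0 ≤ s) (hsr : s ≤ r)
    (hr : 0 < r) :
    min 1 u * ((r + s) / 2) ^ (u - 1) * (r - s) ≤ r ^ u - s ^ u ∧
      min 1 u * ((r + s) / 2) ^ (u - 1) * (r + s) ≤ r ^ u + s ^ u := by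
  set m := (r + s) / 2 with hm
  have hm0 : 0 < m := by positivity
  obtain ⟨x, hx⟩ : ∃ x, x = (r - s) / (r + s) := ⟨_, rfl⟩
  have hrs : 0 < r + s := by linarith
  have hx0 : 0 ≤ x := hx ▸ div_nonneg (by linarith) hrs.le
  have hx1 : x ≤ 1 := by rw [hx, div_le_one hrs]; linarith
  have hr' : r = m * (1 + x) := by rw [hx, hm]; field_simp; ring
  have hs' : s = m * (1 - x) := by rw [hx, hm]; field_simp; ring
  have hru : r ^ u = m ^ u * (1 + x) ^ u := by
    rw [← Real.mul_rpow hm0.le (by linarith), ← hr']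
  have hsu : s ^ u = m ^ u * (1 - x) ^ u := by
    rw [← Real.mul_rpow hm0.le (by linarith), ← hs']
  have hmu : m ^ u = m ^ (u - 1) * m := by
    rw [← Real.rpow_add_one hm0.ne', sub_add_cancel]
  have hdiff : r - s = m * (2 * x) := by linarith
  have hsum : r + s = m * 2 := by linarith
  have hmu0 : 0 ≤ m ^ u := (Real.rpow_pos_of_pos hm0 u).le
  have h1 := mul_le_mul_of_nonneg_left
    (min_mul_le_one_add_rpow_sub_one_sub_rpow hu hx0 hx1) hmu0
  have h2 := mul_le_mul_of_nonneg_left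
    (min_mul_two_le_one_add_rpow_add_one_sub_rpow hu hx0 hx1) hmu0
  rw [hru, hsu, hdiff, hsum, ← mul_sub, ← mul_add]
  refine ⟨le_trans (le_of_eq ?_) h1, le_trans (le_of_eq ?_) h2⟩ <;> rw [hmu] <;> ring

theorem inner_rpow_smul_sub_ge {E : Type*} [NormedAddCommGroup E] [InnerProductSpace ℝ E]
    {p : ℝ} (hp : 1 < p) {a b : E} (hba : ‖b‖ ≤ ‖a‖) (ha : 0 < ‖a‖) :
    min 1 (p - 1) * ((‖a‖ + ‖b‖) / 2) ^ (p - 2) * ‖a - b‖ ^ 2 ≤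
      ⟪‖a‖ ^ (p - 2) • a - ‖b‖ ^ (p - 2) • b, a - b⟫ := by
  obtain ⟨h1, h2⟩ := min_mul_rpow_mean_mul_le (sub_pos.2 hp) (norm_nonneg b) hba ha
  have hpow : ∀ r : ℝ, 0 ≤ r → r ^ (p - 1) = r ^ (p - 2) * r := by
    intro r hr
    rw [← Real.rpow_add_one' hr (by linarith)]
    congr 1
    ring
  rw [show p - 1 - 1 = p - 2 by ring, hpow _ ha.le, hpow _ (norm_nonneg b)] at h1 h2
  have hinner : ⟪‖a‖ ^ (p - 2) • a - ‖b‖ ^ (p - 2) • b, a - b⟫ =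
      ‖a‖ ^ (p - 2) * ‖a‖ ^ 2 + ‖b‖ ^ (p - 2) * ‖b‖ ^ 2
        - (‖a‖ ^ (p - 2) + ‖b‖ ^ (p - 2)) * ⟪a, b⟫ := by
    simp only [inner_sub_left, inner_sub_right, real_inner_smul_left,
      real_inner_self_eq_norm_sq, real_inner_comm a b]
    ring
  rw [hinner, norm_sub_sq_real]
  have hc := abs_real_inner_le_norm a b
  generalize min 1 (p - 1) * ((‖a‖ + ‖b‖) / 2) ^ (p - 2) = K at *
  generalize ‖a‖ ^ (p - 2) = R at *
  generalize ‖b‖ ^ (p - 2) = S at *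
  have h3 := mul_le_mul_of_nonneg_right h1 (sub_nonneg.2 hba)
  have h4 := mul_le_mul_of_nonneg_right h2 (add_nonneg ha.le (norm_nonneg b))
  have hβ : |R + S - 2 * K| * (‖a‖ * ‖b‖) ≤
      R * ‖a‖ ^ 2 + S * ‖b‖ ^ 2 - K * (‖a‖ ^ 2 + ‖b‖ ^ 2) := by
    rcases abs_cases (R + S - 2 * K) with h | h <;> rw [h.1] <;> linarith
  have hle := (le_abs_self ((R + S - 2 * K) * ⟪a, b⟫)).trans_eq (abs_mul _ _)
  have := mul_le_mul_of_nonneg_left hc (abs_nonneg (R + S - 2 * K))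
  linarith

theorem statement0 (n : ℕ) (hn : 1 ≤ n) (p : ℝ) (hp : 1 < p)
    (a b : EuclideanSpace ℝ (Fin n)) (hab : a ≠ b) :
    ⟪‖a‖ ^ (p - 2) • a - ‖b‖ ^ (p - 2) • b, a - b⟫ ≥
      min 1 (p - 1) / 2 ^ (p - 2) * (‖a‖ + ‖b‖) ^ (p - 2) * ‖a - b‖ ^ 2 := by
  have hK : min 1 (p - 1) / 2 ^ (p - 2) * (‖a‖ + ‖b‖) ^ (p - 2) =
      min 1 (p - 1) * ((‖a‖ + ‖b‖) / 2) ^ (p - 2) := by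
    rw [Real.div_rpow (by positivity) zero_le_two]
    ring
  rw [hK, ge_iff_le]
  have hpos : ∀ x y : EuclideanSpace ℝ (Fin n), x ≠ y → ‖y‖ ≤ ‖x‖ → 0 < ‖x‖ := by
    intro x y hxy h
    refine norm_pos_iff.2 fun hx => hxy ?_
    rw [hx, norm_zero] at h
    rw [hx, norm_le_zero_iff.1 h]
  rcases le_total ‖b‖ ‖a‖ with h | h
  · exact inner_rpow_smul_sub_ge hp h (hpos a b hab h)
  · have := inner_rpow_smul_sub_ge hp h (hpos b a hab.symm h)
    rwa [add_comm ‖b‖, norm_sub_rev, ← neg_sub (‖a‖ ^ (p - 2) • a), ← neg_sub a b,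
      inner_neg_neg] at this
end

section
/- Let n ≥ 2 be an integer, p > (n+1)/2 a real number, λ₁, …, λ_{n−1} > 0, and r > 0. Then lim_{ε → 0⁺} ∫_{{y ∈ ℝ^{n−1} : |y| < r}} ( ε^{(2p−n−1)/(2(p−1))} / ( ε + Σ_{i=1}^{n−1} (λ_i/2) y_i² ) )^{p−1} dy = (2π)^{(n−1)/2} Γ(p − (n+1)/2) / ( (λ₁ ⋯ λ_{n−1})^{1/2} Γ(p−1) ). -/
open MeasureTheory Real Filter

section Gaussian

variable {ι : Type*} [Fintype ι]

theorem exp_neg_mul_sum_half_mul_sq (lam : ι → ℝ) (t : ℝ) (x : ι → ℝ) :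
    exp (-(t * ∑ i, lam i / 2 * x i ^ 2)) = ∏ i, exp (-(t * lam i / 2) * x i ^ 2) := by
  rw [← Real.exp_sum, Finset.mul_sum, ← Finset.sum_neg_distrib]
  congr 1
  exact Finset.sum_congr rfl fun i _ => by ring

theorem integrable_exp_neg_mul_sum_half_mul_sq {lam : ι → ℝ} (hlam : ∀ i, 0 < lam i)
    {t : ℝ} (ht : 0 < t) :
    Integrable fun x : ι → ℝ => exp (-(t * ∑ i, lam i / 2 * x i ^ 2)) := by
  simp_rw [exp_neg_mul_sum_half_mul_sq]
  exact Integrable.fintype_prod (f := fun i y => exp (-(t * lam i / 2) * y ^ 2)) fun i =>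
    integrable_exp_neg_mul_sq (by have := hlam i; positivity)

theorem integral_exp_neg_mul_sum_half_mul_sq {lam : ι → ℝ} (hlam : ∀ i, 0 < lam i)
    {t : ℝ} (ht : 0 < t) :
    ∫ x : ι → ℝ, exp (-(t * ∑ i, lam i / 2 * x i ^ 2)) =
      (2 * π) ^ ((Fintype.card ι : ℝ) / 2) / √(∏ i, lam i) *
        t ^ (-((Fintype.card ι : ℝ) / 2)) := by
  simp_rw [exp_neg_mul_sum_half_mul_sq]
  rw [integral_fintype_prod_volume_eq_prod (fun i y => exp (-(t * lam i / 2) * y ^ 2))]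
  simp_rw [integral_gaussian]
  have hprod : 0 ≤ ∏ i, lam i := Finset.prod_nonneg fun i _ => (hlam i).le
  have hfactor (i : ι) : √(π / (t * lam i / 2)) = √(2 * π) / √(lam i) * (√t)⁻¹ := by
    rw [show π / (t * lam i / 2) = (2 * π) / lam i * t⁻¹ by have := hlam i; field_simp,
      Real.sqrt_mul (by have := hlam i; positivity), Real.sqrt_div (by positivity),
      Real.sqrt_inv]
  have hpow {a : ℝ} (ha : 0 ≤ a) : a ^ ((Fintype.card ι : ℝ) / 2) = √a ^ Fintype.card ι := by
    rw [Real.sqrt_eq_rpow, ← Real.rpow_natCast, ← Real.rpow_mul ha]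
    ring_nf
  simp_rw [hfactor]
  rw [Finset.prod_mul_distrib, Finset.prod_div_distrib, Finset.prod_const, Finset.prod_const,
    Finset.card_univ, Real.rpow_neg ht.le, hpow ht.le, hpow (by positivity), inv_pow,
    Real.sqrt_prod _ fun i _ => (hlam i).le]

theorem one_add_sum_half_mul_sq_pos {lam : ι → ℝ} (hlam : ∀ i, 0 < lam i) (x : ι → ℝ) :
    0 < 1 + ∑ i, lam i / 2 * x i ^ 2 := by
  have : 0 ≤ ∑ i, lam i / 2 * x i ^ 2 :=
    Finset.sum_nonneg fun i _ => by have := hlam i; positivity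
  linarith

/-- Rewriting a negative power as a Gamma integral reduces the integral to Gaussian ones. -/
theorem integrable_and_integral_one_add_sum_half_mul_sq_rpow {lam : ι → ℝ}
    (hlam : ∀ i, 0 < lam i) {s : ℝ} (hs : (Fintype.card ι : ℝ) / 2 < s) :
    Integrable (fun x : ι → ℝ => (1 + ∑ i, lam i / 2 * x i ^ 2) ^ (-s)) ∧
    ∫ x : ι → ℝ, (1 + ∑ i, lam i / 2 * x i ^ 2) ^ (-s) =
      (2 * π) ^ ((Fintype.card ι : ℝ) / 2) * Gamma (s - (Fintype.card ι : ℝ) / 2) /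
        (√(∏ i, lam i) * Gamma s) := by
  set d : ℝ := (Fintype.card ι : ℝ) / 2 with hd
  have hs0 : 0 < s := lt_of_le_of_lt (by positivity) hs
  set C : ℝ := (2 * π) ^ d / √(∏ i, lam i) with hC
  let F : (ι → ℝ) → ℝ → ℝ := fun x t =>
    t ^ (s - 1) * exp (-((1 + ∑ i, lam i / 2 * x i ^ 2) * t))
  have hFsplit (x : ι → ℝ) (t : ℝ) : F x t =
      t ^ (s - 1) * exp (-t) * exp (-(t * ∑ i, lam i / 2 * x i ^ 2)) := by
    simp only [F]
    rw [mul_assoc, ← Real.exp_add]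
    ring_nf
  have hinner_t (x : ι → ℝ) :
      ∫ t in Set.Ioi (0 : ℝ), F x t = Gamma s * (1 + ∑ i, lam i / 2 * x i ^ 2) ^ (-s) := by
    have hpos := one_add_sum_half_mul_sq_pos hlam x
    rw [integral_rpow_mul_exp_neg_mul_Ioi hs0 hpos, one_div, Real.inv_rpow hpos.le,
      Real.rpow_neg hpos.le, mul_comm]
  have hinner_x {t : ℝ} (ht : 0 < t) :
      ∫ x, F x t = C * (exp (-t) * t ^ (s - d - 1)) := by
    simp_rw [hFsplit]
    rw [integral_const_mul, integral_exp_neg_mul_sum_half_mul_sq hlam ht, ← hd, ← hC,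
      show s - d - 1 = (s - 1) + (-d) by ring, Real.rpow_add ht]
    ring
  have hF : Integrable (Function.uncurry F)
      ((volume : Measure (ι → ℝ)).prod (volume.restrict (Set.Ioi (0 : ℝ)))) := by
    have hmeas : Measurable (Function.uncurry F) := by
      simp only [F, Function.uncurry_def]
      fun_prop
    refine (integrable_prod_iff' hmeas.aestronglyMeasurable).2 ⟨?_, ?_⟩
    · filter_upwards [ae_restrict_mem measurableSet_Ioi] with t ht
      simp only [Function.uncurry_apply_pair, hFsplit]
      exact (integrable_exp_neg_mul_sum_half_mul_sq hlam ht).const_mul _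
    · refine ((GammaIntegral_convergent (sub_pos.2 hs)).const_mul C).congr ?_
      filter_upwards [ae_restrict_mem measurableSet_Ioi] with t ht
      have ht' : 0 < t := ht
      rw [← hinner_x ht']
      refine integral_congr_ae (Eventually.of_forall fun x => ?_)
      exact (Real.norm_of_nonneg (by simp only [F]; positivity)).symm
  have hG : Gamma s ≠ 0 := (Gamma_pos_of_pos hs0).ne'
  have hswap := integral_integral_swap hF
  have hleft := hF.integral_prod_left
  simp only [Function.uncurry_apply_pair, hinner_t] at hleft
  simp only [hinner_t] at hswap
  rw [setIntegral_congr_fun measurableSet_Ioi fun t ht => hinner_x ht, integral_const_mul,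
    integral_const_mul, ← Gamma_eq_integral (sub_pos.2 hs)] at hswap
  refine ⟨(integrable_const_mul_iff (IsUnit.mk0 _ hG) _).1 hleft, ?_⟩
  rw [eq_div_of_mul_eq hG ((mul_comm _ _).trans hswap), hC, div_mul_eq_mul_div, div_div]

/-- The dilation `y = √ε • x` turns the integral over a ball of fixed radius into the integral of
a fixed function over a ball of radius growing like `1 / √ε`. -/
theorem setIntegral_ball_rpow_div_add_sum_half_mul_sq {lam : ι → ℝ} (hlam : ∀ i, 0 < lam i)
    {s a : ℝ} (ha : a * s = s - (Fintype.card ι : ℝ) / 2) (r : ℝ) {ε : ℝ} (hε : 0 < ε) :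
    ∫ y in Metric.ball (0 : EuclideanSpace ℝ ι) r,
        (ε ^ a / (ε + ∑ i, lam i / 2 * y i ^ 2)) ^ s =
      ∫ x in Metric.ball (0 : EuclideanSpace ℝ ι) (r / √ε),
        (1 + ∑ i, lam i / 2 * x i ^ 2) ^ (-s) := by
  have hsq : 0 < √ε := Real.sqrt_pos.2 hε
  have key := Measure.setIntegral_comp_smul_of_pos (volume : Measure (EuclideanSpace ℝ ι))
    (fun y => (ε ^ a / (ε + ∑ i, lam i / 2 * y i ^ 2)) ^ s)
    (Metric.ball (0 : EuclideanSpace ℝ ι) (r / √ε)) hsq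
  rw [smul_ball hsq.ne', smul_zero, Real.norm_of_nonneg hsq.le, mul_div_cancel₀ _ hsq.ne',
    finrank_euclideanSpace, smul_eq_mul] at key
  have hscale (x : EuclideanSpace ℝ ι) :
      (ε ^ a / (ε + ∑ i, lam i / 2 * (√ε • x) i ^ 2)) ^ s =
        (√ε ^ Fintype.card ι)⁻¹ * (1 + ∑ i, lam i / 2 * x i ^ 2) ^ (-s) := by
    have hpos := one_add_sum_half_mul_sq_pos hlam x
    have hsum : ε + ∑ i, lam i / 2 * (√ε • x) i ^ 2 =
        ε * (1 + ∑ i, lam i / 2 * x i ^ 2) := by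
      rw [mul_add, mul_one, Finset.mul_sum]
      congr 1
      refine Finset.sum_congr rfl fun i _ => ?_
      rw [PiLp.smul_apply, smul_eq_mul, mul_pow, Real.sq_sqrt hε.le]
      ring
    rw [hsum, Real.div_rpow (by positivity) (by positivity), Real.mul_rpow hε.le hpos.le,
      ← Real.rpow_mul hε.le, ha, Real.rpow_sub hε, Real.rpow_neg hpos.le,
      show ε ^ ((Fintype.card ι : ℝ) / 2) = √ε ^ Fintype.card ι by
        rw [Real.sqrt_eq_rpow, ← Real.rpow_natCast, ← Real.rpow_mul hε.le]
        ring_nf]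
    have := (Real.rpow_pos_of_pos hε s).ne'
    field_simp
  simp_rw [hscale] at key
  rw [integral_const_mul] at key
  exact (mul_left_cancel₀ (by positivity) key).symm

end Gaussian

theorem statement15 (n : ℕ) (hn : 2 ≤ n) (p : ℝ) (hp : ((n : ℝ) + 1) / 2 < p)
    (lam : Fin (n - 1) → ℝ) (hlam : ∀ i, 0 < lam i) (r : ℝ) (hr : 0 < r) :
    Tendsto (fun ε : ℝ =>
        ∫ y in Metric.ball (0 : EuclideanSpace ℝ (Fin (n - 1))) r,
          (ε ^ ((2 * p - n - 1) / (2 * (p - 1))) /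
            (ε + ∑ i, lam i / 2 * y i ^ 2)) ^ (p - 1))
      (nhdsWithin 0 (Set.Ioi 0))
      (nhds ((2 * π) ^ (((n : ℝ) - 1) / 2) * Real.Gamma (p - ((n : ℝ) + 1) / 2) /
        (Real.sqrt (∏ i, lam i) * Real.Gamma (p - 1)))) := by
  have hcard : (Fintype.card (Fin (n - 1)) : ℝ) = n - 1 := by
    rw [Fintype.card_fin, Nat.cast_sub (by omega), Nat.cast_one]
  have hn' : (2 : ℝ) ≤ n := by exact_mod_cast hn
  have hp1 : p - 1 ≠ 0 := by linarith
  obtain ⟨hint, hval⟩ := integrable_and_integral_one_add_sum_half_mul_sq_rpow hlam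
    (s := p - 1) (by rw [hcard]; linarith)
  have hvp := PiLp.volume_preserving_ofLp (Fin (n - 1))
  have hemb := (MeasurableEquiv.toLp 2 (Fin (n - 1) → ℝ)).symm.measurableEmbedding
  have hint' := (hvp.integrable_comp_emb hemb).2 hint
  have hval' := (hvp.integral_comp hemb
    fun x : Fin (n - 1) → ℝ => (1 + ∑ i, lam i / 2 * x i ^ 2) ^ (-(p - 1))).trans hval
  rw [hcard, show p - 1 - ((n : ℝ) - 1) / 2 = p - ((n : ℝ) + 1) / 2 by ring] at hval'
  rw [← hval']
  have hradius : Tendsto (fun ε : ℝ => r / √ε) (nhdsWithin 0 (Set.Ioi 0)) atTop := by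
    refine Tendsto.const_mul_atTop hr (tendsto_inv_nhdsGT_zero.comp ?_)
    refine tendsto_nhdsWithin_iff.2 ⟨?_, ?_⟩
    · simpa using (Real.continuous_sqrt.tendsto 0).mono_left nhdsWithin_le_nhds
    · filter_upwards [self_mem_nhdsWithin] with ε hε using Real.sqrt_pos.2 hε
  refine ((aecover_ball (x := 0) hradius).integral_tendsto_of_countably_generated hint').congr' ?_
  filter_upwards [self_mem_nhdsWithin] with ε hε
  refine (setIntegral_ball_rpow_div_add_sum_half_mul_sq hlam ?_ r hε).symm
  rw [hcard]
  field_simp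
  ring
end

section
/- Let n ≥ 2 be an integer, set p := (n+1)/2, and let λ₁, …, λ_{n−1} > 0 and r > 0. Then lim_{ε → 0⁺} |ln ε|^{−1} ∫_{{y ∈ ℝ^{n−1} : |y| < r}} ( ε + Σ_{i=1}^{n−1} (λ_i/2) y_i² )^{−(n−1)/2} dy = (2π)^{(n−1)/2} / ( (λ₁ ⋯ λ_{n−1})^{1/2} Γ((n−1)/2) ). -/
open MeasureTheory Real Filter

/-- The power `x ^ k` lies above `x * (1 - k * (1 - x ^ 2))` on `[0, 1]`. -/
lemma mul_one_sub_le_pow {x : ℝ} (hx0 : 0 ≤ x) (hx1 : x ≤ 1) (k : ℕ) :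
    x * (1 - k * (1 - x ^ 2)) ≤ x ^ k := by
  have h := one_add_mul_le_pow (a := x ^ 2 - 1) (by nlinarith) k
  calc x * (1 - k * (1 - x ^ 2)) = x * (1 + k * (x ^ 2 - 1)) := by ring
    _ ≤ x * (1 + (x ^ 2 - 1)) ^ k := by gcongr
    _ = x ^ (2 * k + 1) := by rw [add_sub_cancel, ← pow_mul]; ring
    _ ≤ x ^ k := pow_le_pow_of_le_one hx0 hx1 (by omega)

lemma rpow_neg_half_eq_inv_sqrt_pow {a : ℝ} (ha : 0 ≤ a) (m : ℕ) :
    a ^ (-((m : ℝ) / 2)) = (√a ^ m)⁻¹ := by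
  rw [rpow_neg ha, Real.sqrt_eq_rpow, ← rpow_mul_natCast ha]
  ring_nf

lemma continuous_add_sq_rpow {ε : ℝ} (hε : 0 < ε) (s : ℝ) :
    Continuous fun t : ℝ => (ε + t ^ 2) ^ s :=
  (by fun_prop : Continuous fun t : ℝ => ε + t ^ 2).rpow_const
    fun t => Or.inl (by positivity)

lemma intervalIntegral_radial_le {ε R : ℝ} (hε : 0 < ε) (hR : 0 ≤ R) (k : ℕ) :
    ∫ t in 0..R, t ^ k * (ε + t ^ 2) ^ (-(((k + 1 : ℕ) : ℝ) / 2)) ≤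
      log (R + √(ε + R ^ 2)) - log ε / 2 := by
  have hderiv : ∀ t ∈ Set.Icc 0 R,
      HasDerivAt (fun t => log (t + √(ε + t ^ 2))) (√(ε + t ^ 2))⁻¹ t := by
    intro t ht
    have h0 : 0 < ε + t ^ 2 := by positivity
    have hq : 0 < √(ε + t ^ 2) := Real.sqrt_pos.2 h0
    have hpos : 0 < t + √(ε + t ^ 2) := add_pos_of_nonneg_of_pos ht.1 hq
    have hb : HasDerivAt (fun t => ε + t ^ 2) (2 * t) t := by
      simpa using (hasDerivAt_pow 2 t).const_add ε
    convert ((hasDerivAt_id' t).fun_add (hb.sqrt h0.ne')).log hpos.ne' using 1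
    field_simp
    ring
  have hcont : Continuous fun t : ℝ => t ^ k * (ε + t ^ 2) ^ (-(((k + 1 : ℕ) : ℝ) / 2)) :=
    (continuous_pow k).mul (continuous_add_sq_rpow hε _)
  have h := intervalIntegral.integral_le_sub_of_hasDeriv_right_of_le hR
    (fun t ht => (hderiv t ht).continuousAt.continuousWithinAt)
    (fun t ht => (hderiv t (Set.Ioo_subset_Icc_self ht)).hasDerivWithinAt)
    (hcont.integrableOn_Icc) (by
      intro t ht
      have hq : 0 < √(ε + t ^ 2) := Real.sqrt_pos.2 (by positivity)
      have htq : t ≤ √(ε + t ^ 2) := Real.le_sqrt_of_sq_le (by linarith)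
      rw [rpow_neg_half_eq_inv_sqrt_pow (by positivity), ← div_eq_mul_inv, inv_eq_one_div,
        div_le_div_iff₀ (by positivity) hq, one_mul, pow_succ _ k]
      exact mul_le_mul_of_nonneg_right (pow_le_pow_left₀ ht.1.le htq k) hq.le)
  convert h using 2
  simp [Real.log_sqrt hε.le]

lemma le_intervalIntegral_radial {ε R : ℝ} (hε : 0 < ε) (hR : 0 < R) (k : ℕ) :
    log R - log ε / 2 - k / 2 ≤
      ∫ t in 0..R, t ^ k * (ε + t ^ 2) ^ (-(((k + 1 : ℕ) : ℝ) / 2)) := by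
  have hderiv : ∀ t : ℝ,
      HasDerivAt (fun t => log (ε + t ^ 2) / 2 + k * ε / 2 * (ε + t ^ 2)⁻¹)
        (t / (ε + t ^ 2) - k * ε * t / (ε + t ^ 2) ^ 2) t := by
    intro t
    have h0 : 0 < ε + t ^ 2 := by positivity
    have hb : HasDerivAt (fun t => ε + t ^ 2) (2 * t) t := by
      simpa using (hasDerivAt_pow 2 t).const_add ε
    refine (((hb.log h0.ne').div_const 2).fun_add
      ((hb.fun_inv h0.ne').const_mul (k * ε / 2))).congr_deriv ?_
    field_simp
    ring
  have hcont : Continuous fun t : ℝ => t ^ k * (ε + t ^ 2) ^ (-(((k + 1 : ℕ) : ℝ) / 2)) :=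
    (continuous_pow k).mul (continuous_add_sq_rpow hε _)
  have h := intervalIntegral.sub_le_integral_of_hasDeriv_right_of_le hR.le
    (fun t _ => (hderiv t).continuousAt.continuousWithinAt)
    (fun t _ => (hderiv t).hasDerivWithinAt)
    (hcont.integrableOn_Icc) (by
      intro t ht
      have h0 : 0 < ε + t ^ 2 := by positivity
      have hq : 0 < √(ε + t ^ 2) := Real.sqrt_pos.2 h0
      have htq : t ≤ √(ε + t ^ 2) := Real.le_sqrt_of_sq_le (by linarith)
      have hsq : √(ε + t ^ 2) ^ 2 = ε + t ^ 2 := Real.sq_sqrt h0.le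
      rw [rpow_neg_half_eq_inv_sqrt_pow h0.le]
      have key := mul_one_sub_le_pow (div_nonneg ht.1.le hq.le) ((div_le_one hq).2 htq) k
      set q := √(ε + t ^ 2)
      have hε' : ε = q ^ 2 - t ^ 2 := by linarith
      calc t / (ε + t ^ 2) - k * ε * t / (ε + t ^ 2) ^ 2
          = t / q * (1 - k * (1 - (t / q) ^ 2)) * q⁻¹ := by
            rw [← hsq, hε']; field_simp
        _ ≤ (t / q) ^ k * q⁻¹ := by gcongr
        _ = t ^ k * (q ^ (k + 1))⁻¹ := by rw [div_pow, pow_succ]; field_simp)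
  refine le_trans ?_ h
  have h1 : log R ≤ log (ε + R ^ 2) / 2 := by
    have : log (R ^ 2) ≤ log (ε + R ^ 2) := log_le_log (by positivity) (by linarith)
    rw [log_pow] at this
    push_cast at this
    linarith
  have h2 : (0 : ℝ) ≤ k * ε / 2 * (ε + R ^ 2)⁻¹ := by positivity
  have h3 : (k : ℝ) * ε / 2 * ε⁻¹ = k / 2 := by field_simp
  simp only [ne_eq, OfNat.ofNat_ne_zero, not_false_eq_true, zero_pow, add_zero, h3]
  linarith

/-- A quantity within a bounded distance of `-c * log ε` is asymptotic to `c * |log ε|`. -/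
lemma tendsto_abs_log_inv_mul_of_le {f : ℝ → ℝ} {c A B : ℝ}
    (hA : ∀ᶠ ε in nhdsWithin 0 (Set.Ioi 0), A - c * log ε ≤ f ε)
    (hB : ∀ᶠ ε in nhdsWithin 0 (Set.Ioi 0), f ε ≤ B - c * log ε) :
    Tendsto (fun ε => |log ε|⁻¹ * f ε) (nhdsWithin 0 (Set.Ioi 0)) (nhds c) := by
  have hlog : ∀ᶠ ε in nhdsWithin (0 : ℝ) (Set.Ioi 0), log ε < 0 :=
    tendsto_log_nhdsGT_zero.eventually_lt_atBot 0
  have hinv : Tendsto (fun ε => |log ε|⁻¹) (nhdsWithin (0 : ℝ) (Set.Ioi 0)) (nhds 0) :=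
    (tendsto_abs_atBot_atTop.comp tendsto_log_nhdsGT_zero).inv_tendsto_atTop
  have hlim (A : ℝ) : Tendsto (fun ε => |log ε|⁻¹ * A + c) (nhdsWithin (0 : ℝ) (Set.Ioi 0))
      (nhds c) := by
    simpa using (hinv.mul_const A).add_const c
  have heq (A ε : ℝ) (h : log ε < 0) : |log ε|⁻¹ * A + c = |log ε|⁻¹ * (A - c * log ε) := by
    have h' := h.ne
    rw [abs_of_neg h]
    field_simp
    ring
  refine tendsto_of_tendsto_of_tendsto_of_le_of_le' (hlim A) (hlim B) ?_ ?_
  · filter_upwards [hlog, hA] with ε h h'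
    rw [heq A ε h]
    gcongr
  · filter_upwards [hlog, hB] with ε h h'
    rw [heq B ε h]
    gcongr

lemma tendsto_abs_log_inv_mul_intervalIntegral_radial {R : ℝ} (hR : 0 < R) (k : ℕ) :
    Tendsto (fun ε => |log ε|⁻¹ *
        ∫ t in 0..R, t ^ k * (ε + t ^ 2) ^ (-(((k + 1 : ℕ) : ℝ) / 2)))
      (nhdsWithin 0 (Set.Ioi 0)) (nhds (1 / 2)) := by
  refine tendsto_abs_log_inv_mul_of_le (A := log R - k / 2) (B := log (R + √(1 + R ^ 2))) ?_ ?_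
  · filter_upwards [self_mem_nhdsWithin] with ε hε
    have := le_intervalIntegral_radial hε hR k
    linarith
  · filter_upwards [Ioo_mem_nhdsGT one_pos] with ε hε
    have h := intervalIntegral_radial_le hε.1 hR.le k
    have h' : log (R + √(ε + R ^ 2)) ≤ log (R + √(1 + R ^ 2)) := by
      have := hε.2.le
      gcongr
    linarith

section

open Module

variable {E : Type*} [NormedAddCommGroup E] [NormedSpace ℝ E] [FiniteDimensional ℝ E]
  [MeasurableSpace E] [BorelSpace E] (μ : Measure E) [μ.IsAddHaarMeasure]

lemma setIntegral_ball_fun_norm [Nontrivial E] (f : ℝ → ℝ) {R : ℝ} (hR : 0 ≤ R) :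
    ∫ x in Metric.ball (0 : E) R, f ‖x‖ ∂μ =
      finrank ℝ E * μ.real (Metric.ball 0 1) *
        ∫ t in 0..R, t ^ (finrank ℝ E - 1) * f t := by
  have h := integral_fun_norm_addHaar μ ((Set.Iio R).indicator f)
  rw [← integral_indicator Metric.isOpen_ball.measurableSet]
  have h1 : (Metric.ball (0 : E) R).indicator (fun x => f ‖x‖) =
      fun x => (Set.Iio R).indicator f ‖x‖ := by
    ext x
    simp [Set.indicator]
  rw [h1, h, nsmul_eq_mul, smul_eq_mul, mul_assoc, intervalIntegral.integral_of_le hR,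
    integral_Ioc_eq_integral_Ioo]
  have h2 : ∀ t : ℝ, t ^ (finrank ℝ E - 1) • (Set.Iio R).indicator f t =
      (Set.Iio R).indicator (fun t => t ^ (finrank ℝ E - 1) * f t) t := by
    intro t
    by_cases ht : t < R <;> simp [Set.indicator, ht]
  simp_rw [h2]
  rw [setIntegral_indicator measurableSet_Iio, Set.Ioi_inter_Iio]

lemma tendsto_abs_log_inv_mul_setIntegral_ball [Nontrivial E] {R : ℝ} (hR : 0 < R) :
    Tendsto (fun ε => |log ε|⁻¹ *
        ∫ x in Metric.ball (0 : E) R, (ε + ‖x‖ ^ 2) ^ (-((finrank ℝ E : ℝ) / 2)) ∂μ)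
      (nhdsWithin 0 (Set.Ioi 0))
      (nhds (finrank ℝ E * μ.real (Metric.ball 0 1) / 2)) := by
  obtain ⟨k, hk⟩ : ∃ k, finrank ℝ E = k + 1 := Nat.exists_eq_add_one.2 finrank_pos
  have h := (tendsto_abs_log_inv_mul_intervalIntegral_radial hR k).const_mul
    (finrank ℝ E * μ.real (Metric.ball 0 1))
  rw [mul_one_div] at h
  refine h.congr fun ε => ?_
  rw [setIntegral_ball_fun_norm μ (fun t => (ε + t ^ 2) ^ (-((finrank ℝ E : ℝ) / 2))) hR.le, hk,
    Nat.add_sub_cancel]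
  ring

lemma setIntegral_preimage_ball_fun_norm {L : E →ₗ[ℝ] E} (hL : LinearMap.det L ≠ 0) {f : ℝ → ℝ}
    (hf : Continuous f) (R : ℝ) :
    ∫ x in L ⁻¹' Metric.ball 0 R, f ‖L x‖ ∂μ =
      |(LinearMap.det L)⁻¹| * ∫ x in Metric.ball 0 R, f ‖x‖ ∂μ := by
  have hLc : Continuous L := L.continuous_of_finiteDimensional
  rw [← setIntegral_map (f := fun x => f ‖x‖) Metric.isOpen_ball.measurableSet
      (hf.comp continuous_norm).aestronglyMeasurable hLc.aemeasurable,
    Measure.map_linearMap_addHaar_eq_smul_addHaar μ hL, Measure.restrict_smul,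
    integral_smul_measure, ENNReal.toReal_ofReal (abs_nonneg _), smul_eq_mul]

/-- Logarithmic divergence at `0` of the integral of the critical power of a quadratic form. -/
lemma tendsto_abs_log_inv_mul_setIntegral_ball_linearMap [Nontrivial E] {L : E →ₗ[ℝ] E}
    (hL : LinearMap.det L ≠ 0) {r : ℝ} (hr : 0 < r) :
    Tendsto (fun ε => |log ε|⁻¹ *
        ∫ x in Metric.ball (0 : E) r, (ε + ‖L x‖ ^ 2) ^ (-((finrank ℝ E : ℝ) / 2)) ∂μ)
      (nhdsWithin 0 (Set.Ioi 0))
      (nhds (|(LinearMap.det L)⁻¹| * (finrank ℝ E * μ.real (Metric.ball 0 1) / 2))) := by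
  have hLc : Continuous L := L.continuous_of_finiteDimensional
  obtain ⟨C, hC, hCL⟩ : ∃ C > 0, ∀ x, ‖L x‖ ≤ C * ‖x‖ :=
    (LinearMap.toContinuousLinearMap L).bound
  obtain ⟨D, hD, hDL⟩ : ∃ D > 0, ∀ x, ‖x‖ ≤ D * ‖L x‖ := by
    obtain ⟨D, hD, h⟩ := (LinearMap.toContinuousLinearMap
      (LinearMap.equivOfDetNeZero L hL).symm.toLinearMap).bound
    refine ⟨D, hD, fun x => ?_⟩
    have hx := h (L x)
    have : (LinearMap.equivOfDetNeZero L hL).symm (L x) = x :=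
      (LinearMap.equivOfDetNeZero L hL).symm_apply_apply x
    simpa [this] using hx
  have hlim {R : ℝ} (hR : 0 < R) := (tendsto_abs_log_inv_mul_setIntegral_ball μ hR).const_mul
    |(LinearMap.det L)⁻¹|
  have hintegrable {ε : ℝ} (hε : 0 < ε) {s : Set E} {R : ℝ} (hs : s ⊆ Metric.closedBall 0 R) :
      IntegrableOn (fun x => (ε + ‖L x‖ ^ 2) ^ (-((finrank ℝ E : ℝ) / 2))) s μ :=
    (((continuous_add_sq_rpow hε _).comp hLc.norm).continuousOn.integrableOn_compact
      (isCompact_closedBall 0 R)).mono_set hs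
  have hnonneg {ε : ℝ} (hε : 0 < ε) (ν : Measure E) :
      0 ≤ᵐ[ν] fun x => (ε + ‖L x‖ ^ 2) ^ (-((finrank ℝ E : ℝ) / 2)) :=
    Eventually.of_forall fun x => by positivity
  refine tendsto_of_tendsto_of_tendsto_of_le_of_le' (hlim (div_pos hr hD)) (hlim (mul_pos hC hr))
    ?_ ?_
  · filter_upwards [self_mem_nhdsWithin] with ε hε
    rw [mul_left_comm, ← setIntegral_preimage_ball_fun_norm μ hL (continuous_add_sq_rpow hε _)]
    refine mul_le_mul_of_nonneg_left ?_ (by positivity)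
    refine setIntegral_mono_set (hintegrable hε Metric.ball_subset_closedBall) (hnonneg hε _)
      (LE.le.eventuallyLE fun x hx => ?_)
    simp only [Set.mem_preimage, mem_ball_zero_iff, lt_div_iff₀' hD] at hx ⊢
    exact (hDL x).trans_lt hx
  · filter_upwards [self_mem_nhdsWithin] with ε hε
    rw [mul_left_comm |(LinearMap.det L)⁻¹|,
      ← setIntegral_preimage_ball_fun_norm μ hL (continuous_add_sq_rpow hε _)]
    refine mul_le_mul_of_nonneg_left ?_ (by positivity)
    refine setIntegral_mono_set (hintegrable hε (R := D * (C * r)) fun x hx => ?_) (hnonneg hε _)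
      (LE.le.eventuallyLE fun x hx => ?_)
    · simp only [Set.mem_preimage, mem_ball_zero_iff, mem_closedBall_zero_iff] at hx ⊢
      exact (hDL x).trans (by gcongr)
    · simp only [Set.mem_preimage, mem_ball_zero_iff] at hx ⊢
      exact (hCL x).trans_lt (by gcongr)

end

lemma EuclideanSpace.card_mul_volume_real_ball (m : ℕ) (hm : 0 < m) :
    m * volume.real (Metric.ball (0 : EuclideanSpace ℝ (Fin m)) 1) =
      2 * π ^ ((m : ℝ) / 2) / Gamma ((m : ℝ) / 2) := by
  have : Nonempty (Fin m) := Fin.pos_iff_nonempty.1 hm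
  have hm' : (0 : ℝ) < m := by exact_mod_cast hm
  have hΓ : 0 < Gamma ((m : ℝ) / 2) := Gamma_pos_of_pos (by positivity)
  have hpi : √π ^ m = π ^ ((m : ℝ) / 2) := by
    rw [Real.sqrt_eq_rpow, ← rpow_mul_natCast pi_pos.le]
    ring_nf
  rw [measureReal_def, EuclideanSpace.volume_ball, Fintype.card_fin, ENNReal.ofReal_one, one_pow,
    one_mul, Gamma_add_one (by positivity), hpi, ENNReal.toReal_ofReal (by positivity)]
  field_simp

lemma tendsto_abs_log_inv_mul_setIntegral_ball_diagonal {m : ℕ} (hm : 0 < m)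
    {lam : Fin m → ℝ} (hlam : ∀ i, 0 < lam i) {r : ℝ} (hr : 0 < r) :
    Tendsto (fun ε : ℝ =>
        |log ε|⁻¹ *
          ∫ y in Metric.ball (0 : EuclideanSpace ℝ (Fin m)) r,
            (ε + ∑ i, lam i / 2 * y i ^ 2) ^ (-((m : ℝ) / 2)))
      (nhdsWithin 0 (Set.Ioi 0))
      (nhds ((2 * π) ^ ((m : ℝ) / 2) / (√(∏ i, lam i) * Gamma ((m : ℝ) / 2)))) := by
  have : Nonempty (Fin m) := Fin.pos_iff_nonempty.1 hm
  set L := Matrix.toEuclideanLin (𝕜 := ℝ) (Matrix.diagonal fun i => √(lam i / 2)) with hLdef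
  have hprod : 0 < ∏ i, lam i := Finset.prod_pos fun i _ => hlam i
  have hdet : LinearMap.det L = √(∏ i, lam i) / 2 ^ ((m : ℝ) / 2) := by
    rw [hLdef, LinearMap.det_toLpLin, Matrix.det_diagonal]
    simp_rw [Real.sqrt_div (hlam _).le, Finset.prod_div_distrib]
    rw [Real.sqrt_eq_rpow, Finset.prod_const, Finset.card_univ, Fintype.card_fin,
      Real.sqrt_eq_rpow, ← rpow_mul_natCast (by norm_num),
      ← Real.finsetProd_rpow _ _ fun i _ => (hlam i).le]
    simp only [Real.sqrt_eq_rpow]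
    ring_nf
  have hdet_pos : 0 < LinearMap.det L := by rw [hdet]; positivity
  have hnorm (y : EuclideanSpace ℝ (Fin m)) : ‖L y‖ ^ 2 = ∑ i, lam i / 2 * y i ^ 2 := by
    rw [EuclideanSpace.real_norm_sq_eq]
    refine Finset.sum_congr rfl fun i _ => ?_
    rw [hLdef, Matrix.ofLp_toLpLin, Matrix.toLin'_apply, Matrix.mulVec_diagonal, mul_pow,
      Real.sq_sqrt (div_nonneg (hlam i).le zero_le_two)]
  have h := tendsto_abs_log_inv_mul_setIntegral_ball_linearMap volume hdet_pos.ne' hr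
  simp only [hnorm, finrank_euclideanSpace, Fintype.card_fin] at h
  convert h using 2
  rw [EuclideanSpace.card_mul_volume_real_ball m hm, abs_of_pos (inv_pos.2 hdet_pos), hdet,
    mul_rpow zero_le_two pi_pos.le]
  have hΓ : 0 < Gamma ((m : ℝ) / 2) := Gamma_pos_of_pos (by positivity)
  field_simp

theorem statement16 (n : ℕ) (hn : 2 ≤ n)
    (lam : Fin (n - 1) → ℝ) (hlam : ∀ i, 0 < lam i) (r : ℝ) (hr : 0 < r) :
    Tendsto (fun ε : ℝ =>
        |Real.log ε|⁻¹ *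
          ∫ y in Metric.ball (0 : EuclideanSpace ℝ (Fin (n - 1))) r,
            (ε + ∑ i, lam i / 2 * y i ^ 2) ^ (-(((n : ℝ) - 1) / 2)))
      (nhdsWithin 0 (Set.Ioi 0))
      (nhds ((2 * π) ^ (((n : ℝ) - 1) / 2) /
        (Real.sqrt (∏ i, lam i) * Real.Gamma (((n : ℝ) - 1) / 2)))) := by
  have hcast : (n : ℝ) - 1 = ((n - 1 : ℕ) : ℝ) := by rw [Nat.cast_sub (by omega), Nat.cast_one]
  rw [hcast]
  exact tendsto_abs_log_inv_mul_setIntegral_ball_diagonal (by omega) hlam hr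
end

section
/- Let n ≥ 2 be an integer, p ≥ (n+1)/2 a real number, c₁ > 0, and let h : ℝ^{n−1} → ℝ be a twice continuously differentiable function with h(0') = 0, ∇h(0') = 0, and h(y) ≥ c₁|y|² for 0 < |y| < 1. Define, for ε ∈ (0,1), Θ(ε) := ε^{(2p−n−1)/(2(p−1))} if p > (n+1)/2 and Θ(ε) := |ln ε|^{−1/(p−1)} if p = (n+1)/2, and set K := (det D²h(0'))^{1/2} Γ(p−1) / ( (2π)^{(n−1)/2} Γ(p − (n+1)/2) ) if p > (n+1)/2 and K := (det D²h(0'))^{1/2} Γ((n−1)/2) / (2π)^{(n−1)/2} if p = (n+1)/2. Then the iterated limit lim_{r → 0⁺} lim_{ε → 0⁺} ∫_{{y ∈ ℝ^{n−1} : |y| < r}} ( Θ(ε) / ( ε + h(y) ) )^{p−1} dy = 1/K holds; precisely: for every η > 0 there exists r₀ ∈ (0,1) such that for every r ∈ (0, r₀) there exists ε₀ > 0 such that for every ε ∈ (0, ε₀), | ∫_{{|y| < r}} ( Θ(ε)/(ε + h(y)) )^{p−1} dy − 1/K | < η. -/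
open MeasureTheory Real Filter

noncomputable section

/-- The determinant of the Hessian matrix of `h` at the origin. -/
def hessDet {m : ℕ} (h : EuclideanSpace ℝ (Fin m) → ℝ) : ℝ :=
  Matrix.det (Matrix.of fun i j : Fin m =>
    fderiv ℝ (fun y => fderiv ℝ h y (EuclideanSpace.single j 1)) 0 (EuclideanSpace.single i 1))

/-- `Θ(ε)`. -/
def Theta (n : ℕ) (p ε : ℝ) : ℝ :=
  if ((n : ℝ) + 1) / 2 < p then ε ^ ((2 * p - n - 1) / (2 * (p - 1)))
  else |Real.log ε| ^ (-(1 / (p - 1)))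

/-- The constant `K`. -/
def Kconst (n : ℕ) (p : ℝ) (h : EuclideanSpace ℝ (Fin (n - 1)) → ℝ) : ℝ :=
  if ((n : ℝ) + 1) / 2 < p then
    Real.sqrt (hessDet h) * Real.Gamma (p - 1) /
      ((2 * π) ^ (((n : ℝ) - 1) / 2) * Real.Gamma (p - ((n : ℝ) + 1) / 2))
  else
    Real.sqrt (hessDet h) * Real.Gamma (((n : ℝ) - 1) / 2) / (2 * π) ^ (((n : ℝ) - 1) / 2)

open scoped Topology

theorem integral_one_add_sq_norm_rpow_neg {E : Type*} [NormedAddCommGroup E]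
    [InnerProductSpace ℝ E] [FiniteDimensional ℝ E] [MeasurableSpace E] [BorelSpace E]
    {q : ℝ} (hq : (Module.finrank ℝ E : ℝ) / 2 < q) :
    ∫ v : E, (1 + ‖v‖ ^ 2) ^ (-q) =
      π ^ ((Module.finrank ℝ E : ℝ) / 2) * Gamma (q - (Module.finrank ℝ E : ℝ) / 2) / Gamma q := by
  set d : ℝ := (Module.finrank ℝ E : ℝ) / 2 with hd
  have hd0 : 0 ≤ d := by positivity
  have hq0 : 0 < q := hd0.trans_lt hq
  have hΓ : Gamma q ≠ 0 := (Gamma_pos_of_pos hq0).ne'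
  let f : E → ℝ → ℝ := fun v t => t ^ (q - 1) * exp (-((1 + ‖v‖ ^ 2) * t))
  have hgauss : ∀ t ∈ Set.Ioi (0 : ℝ),
      ∫ v : E, f v t = π ^ d * (t ^ (q - d - 1) * exp (-(1 * t))) := by
    intro t ht
    have ht : 0 < t := ht
    have h1 : ∀ v : E, f v t = t ^ (q - 1) * exp (-t) * exp (-t * ‖v‖ ^ 2) := by
      intro v
      simp only [f]
      rw [mul_assoc, ← exp_add]
      ring_nf
    simp_rw [h1]
    rw [integral_const_mul, GaussianFourier.integral_rexp_neg_mul_sq_norm ht, ← hd,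
      div_rpow pi_pos.le ht.le, show q - d - 1 = (q - 1) - d by ring, rpow_sub ht (q - 1) d, one_mul]
    ring
  have hint : Integrable (Function.uncurry f) (volume.prod (volume.restrict (Set.Ioi 0))) := by
    rw [integrable_prod_iff']
    · constructor
      · filter_upwards [ae_restrict_mem measurableSet_Ioi] with t ht
        refine Integrable.of_integral_ne_zero ?_
        rw [show (fun v : E => Function.uncurry f (v, t)) = fun v => f v t from rfl, hgauss t ht]
        have ht : 0 < t := ht
        positivity
      · have : Integrable (fun t : ℝ => π ^ d * (t ^ (q - d - 1) * exp (-(1 * t))))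
            (volume.restrict (Set.Ioi 0)) := by
          have := GammaIntegral_convergent (sub_pos.2 hq)
          refine (Integrable.const_mul this (π ^ d)).congr (ae_of_all _ fun t => ?_)
          simp only [one_mul]
          ring
        refine this.congr ?_
        filter_upwards [ae_restrict_mem measurableSet_Ioi] with t ht
        rw [← hgauss t ht]
        refine integral_congr_ae (ae_of_all _ fun v => ?_)
        have ht : 0 < t := ht
        simp only [Function.uncurry, f]
        rw [norm_of_nonneg (by positivity)]
    · refine Measurable.aestronglyMeasurable ?_
      simp only [Function.uncurry_def, f]
      fun_prop
  have hswap := integral_integral_swap hint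
  rw [setIntegral_congr_fun measurableSet_Ioi hgauss, integral_const_mul,
    integral_rpow_mul_exp_neg_mul_Ioi (sub_pos.2 hq) one_pos] at hswap
  have hleft : ∀ v : E, ∫ t in Set.Ioi 0, f v t = (1 + ‖v‖ ^ 2) ^ (-q) * Gamma q := by
    intro v
    have hv : 0 < 1 + ‖v‖ ^ 2 := by positivity
    simp only [f]
    rw [integral_rpow_mul_exp_neg_mul_Ioi hq0 hv, one_div, inv_rpow hv.le, rpow_neg hv.le]
  simp_rw [hleft] at hswap
  rw [integral_mul_const] at hswap
  rw [eq_div_iff hΓ, hswap]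
  simp

open scoped MatrixOrder Matrix Matrix.Norms.L2Operator in
theorem Matrix.PosSemidef.exists_transpose_mul_self {ι : Type*} [Fintype ι] [DecidableEq ι]
    {M : Matrix ι ι ℝ} (hM : M.PosSemidef) : ∃ B : Matrix ι ι ℝ, M = Bᵀ * B := by
  obtain ⟨B, hB⟩ := CStarAlgebra.nonneg_iff_eq_star_mul_self.mp hM.nonneg
  exact ⟨B, by rw [hB, Matrix.star_eq_conjTranspose, Matrix.conjTranspose_eq_transpose_of_trivial]⟩

theorem integral_comp_linearMap_eq {E : Type*} [NormedAddCommGroup E] [NormedSpace ℝ E]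
    [MeasurableSpace E] [BorelSpace E] [FiniteDimensional ℝ E] (μ : Measure E) [μ.IsAddHaarMeasure]
    {L : E →ₗ[ℝ] E} (hL : LinearMap.det L ≠ 0) (f : E → ℝ) :
    ∫ v, f (L v) ∂μ = |LinearMap.det L|⁻¹ * ∫ v, f v ∂μ := by
  have hemb : MeasurableEmbedding L :=
    (LinearEquiv.ofIsUnitDet (v := Module.finBasis ℝ E) (v' := Module.finBasis ℝ E) (f := L) (by
      rw [LinearMap.det_toMatrix]
      exact hL.isUnit)).toContinuousLinearEquiv.toHomeomorph.measurableEmbedding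
  rw [← hemb.integral_map, Measure.map_linearMap_addHaar_eq_smul_addHaar μ hL, integral_smul_measure,
    ENNReal.toReal_ofReal (abs_nonneg _), abs_inv, smul_eq_mul]

open scoped Matrix in
theorem integral_one_add_quadratic_rpow_neg {m : ℕ} {M : Matrix (Fin m) (Fin m) ℝ} (hM : M.PosDef)
    {q : ℝ} (hq : (m : ℝ) / 2 < q) :
    ∫ v : EuclideanSpace ℝ (Fin m), (1 + (v.ofLp ⬝ᵥ M *ᵥ v.ofLp) / 2) ^ (-q) =
      (2 * π) ^ ((m : ℝ) / 2) * Gamma (q - (m : ℝ) / 2) / (√M.det * Gamma q) := by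
  obtain ⟨B, hB⟩ := hM.posSemidef.exists_transpose_mul_self
  have hdet : M.det = B.det ^ 2 := by rw [hB, Matrix.det_mul, Matrix.det_transpose, sq]
  have hB0 : B.det ≠ 0 := by
    have := hM.det_pos
    rw [hdet] at this
    exact fun h => by simp [h] at this
  have hsq : √M.det = |B.det| := by rw [hdet, sqrt_sq_eq_abs]
  let L : EuclideanSpace ℝ (Fin m) →ₗ[ℝ] EuclideanSpace ℝ (Fin m) :=
    Matrix.toLpLin 2 2 ((√2)⁻¹ • B)
  have hLdet : LinearMap.det L = (√2)⁻¹ ^ m * B.det := by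
    simp only [L]
    rw [Matrix.toLpLin_eq_toLin, LinearMap.det_toLin, Matrix.det_smul, Fintype.card_fin]
  have h2 : (0 : ℝ) < √2 := by positivity
  have hL0 : LinearMap.det L ≠ 0 := by
    rw [hLdet]
    positivity
  have hnorm : ∀ v : EuclideanSpace ℝ (Fin m), ‖L v‖ ^ 2 = (v.ofLp ⬝ᵥ M *ᵥ v.ofLp) / 2 := by
    intro v
    have h1 : L v = (√2)⁻¹ • WithLp.toLp 2 (B *ᵥ v.ofLp) := by
      simp only [L, Matrix.toLpLin_apply, Matrix.smul_mulVec, WithLp.toLp_smul]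
    rw [h1, norm_smul, mul_pow, norm_inv, norm_of_nonneg h2.le, inv_pow, sq_sqrt zero_le_two, hB,
      ← Matrix.mulVec_mulVec, Matrix.dotProduct_mulVec, Matrix.vecMul_transpose,
      EuclideanSpace.real_norm_sq_eq, dotProduct, div_eq_inv_mul]
    simp only [sq]
  have hmain := integral_comp_linearMap_eq volume hL0 fun w => (1 + ‖w‖ ^ 2) ^ (-q)
  simp_rw [hnorm] at hmain
  rw [hmain, integral_one_add_sq_norm_rpow_neg (by simpa using hq), hLdet, hsq, abs_mul,
    abs_of_pos (by positivity), finrank_euclideanSpace_fin, mul_rpow zero_le_two pi_pos.le]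
  have h3 : (√2)⁻¹ ^ m = ((2 : ℝ) ^ ((m : ℝ) / 2))⁻¹ := by
    rw [inv_pow, sqrt_eq_rpow, ← rpow_natCast, ← rpow_mul zero_le_two]
    ring_nf
  rw [h3]
  have := abs_pos.2 hB0
  field_simp

theorem tendsto_div_sq_of_contDiff_two {E : Type*} [NormedAddCommGroup E] [NormedSpace ℝ E]
    {h : E → ℝ} (hC2 : ContDiff ℝ 2 h) (h0 : h 0 = 0) (hd0 : fderiv ℝ h 0 = 0) (v : E) :
    Tendsto (fun s : ℝ => h (s • v) / s ^ 2) (𝓝[>] 0) (𝓝 (fderiv ℝ (fderiv ℝ h) 0 v v / 2)) := by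
  have hline : ∀ s : ℝ, HasDerivAt (fun s : ℝ => s • v) v s := fun s => by
    simpa using (hasDerivAt_id s).smul_const v
  have hf : ∀ s : ℝ, HasDerivAt (fun s : ℝ => h (s • v)) (fderiv ℝ h (s • v) v) s := fun s =>
    ((hC2.differentiable two_ne_zero (s • v)).hasFDerivAt).comp_hasDerivAt s (hline s)
  have hfd : DifferentiableAt ℝ (fderiv ℝ h) ((0 : ℝ) • v) :=
    (hC2.fderiv_right (m := 1) (by norm_num)).differentiable one_ne_zero _
  have hf' : HasDerivAt (fun s : ℝ => fderiv ℝ h (s • v) v) (fderiv ℝ (fderiv ℝ h) 0 v v) 0 := by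
    have hG : HasDerivAt (fun s : ℝ => fderiv ℝ h (s • v)) (fderiv ℝ (fderiv ℝ h) 0 v) 0 := by
      have := hfd.hasFDerivAt.comp_hasDerivAt (0 : ℝ) (hline 0)
      rwa [zero_smul] at this
    simpa using hG.clm_apply (hasDerivAt_const 0 v)
  refine HasDerivAt.lhopital_zero_nhdsGT (Eventually.of_forall hf)
    (Eventually.of_forall fun s => by simpa using hasDerivAt_pow 2 s) ?_ ?_ ?_ ?_
  · filter_upwards [self_mem_nhdsWithin] with s hs
    have hs : 0 < s := hs
    positivity
  · have := (hf 0).continuousAt.tendsto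
    simp only [zero_smul, h0] at this
    exact this.mono_left nhdsWithin_le_nhds
  · have := (continuous_pow 2 (M := ℝ)).tendsto 0
    simp only [ne_eq, OfNat.ofNat_ne_zero, not_false_eq_true, zero_pow] at this
    exact this.mono_left nhdsWithin_le_nhds
  · have h1 := (hasDerivAt_iff_tendsto_slope.1 hf').mono_left
      (nhdsWithin_mono 0 (fun x (hx : (0 : ℝ) < x) => hx.ne'))
    refine (h1.div_const 2).congr fun s => ?_
    simp [slope_def_field, hd0]
    ring

theorem fderiv_fderiv_pos {E : Type*} [NormedAddCommGroup E] [NormedSpace ℝ E]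
    {h : E → ℝ} (hC2 : ContDiff ℝ 2 h) (h0 : h 0 = 0) (hd0 : fderiv ℝ h 0 = 0) {c : ℝ} (hc : 0 < c)
    (hlb : ∀ y : E, 0 < ‖y‖ → ‖y‖ < 1 → c * ‖y‖ ^ 2 ≤ h y) {v : E} (hv : v ≠ 0) :
    0 < fderiv ℝ (fderiv ℝ h) 0 v v := by
  have hv' := norm_pos_iff.2 hv
  have : c * ‖v‖ ^ 2 ≤ fderiv ℝ (fderiv ℝ h) 0 v v / 2 := by
    refine ge_of_tendsto (tendsto_div_sq_of_contDiff_two hC2 h0 hd0 v) ?_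
    filter_upwards [Ioo_mem_nhdsGT (inv_pos.2 hv')] with s hs
    have hs0 : 0 < s := hs.1
    have hn : ‖s • v‖ = s * ‖v‖ := by rw [norm_smul, norm_of_nonneg hs0.le]
    have := hlb (s • v) (by rw [hn]; positivity) (by
      rw [hn]; exact (lt_inv_mul_iff₀' hv').1 (by simpa using hs.2))
    rw [le_div_iff₀ (by positivity)]
    rw [hn] at this
    linarith
  have : 0 < c * ‖v‖ ^ 2 := by positivity
  linarith

open scoped Matrix in
theorem exists_posDef_hessian {m : ℕ} {h : EuclideanSpace ℝ (Fin m) → ℝ} (hC2 : ContDiff ℝ 2 h)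
    (h0 : h 0 = 0) (hd0 : fderiv ℝ h 0 = 0) {c : ℝ} (hc : 0 < c)
    (hlb : ∀ y : EuclideanSpace ℝ (Fin m), 0 < ‖y‖ → ‖y‖ < 1 → c * ‖y‖ ^ 2 ≤ h y) :
    ∃ M : Matrix (Fin m) (Fin m) ℝ, M.PosDef ∧ M.det = hessDet h ∧
      ∀ v : EuclideanSpace ℝ (Fin m),
        fderiv ℝ (fderiv ℝ h) 0 v v = v.ofLp ⬝ᵥ M *ᵥ v.ofLp := by
  have hfd : DifferentiableAt ℝ (fderiv ℝ h) 0 :=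
    (hC2.fderiv_right (m := 1) (by norm_num)).differentiable one_ne_zero _
  set b := fderiv ℝ (fderiv ℝ h) 0 with hb
  have hentry : ∀ i j : Fin m,
      fderiv ℝ (fun y => fderiv ℝ h y (EuclideanSpace.single j 1)) 0 (EuclideanSpace.single i 1) =
        b (EuclideanSpace.single i 1) (EuclideanSpace.single j 1) := by
    intro i j
    rw [fderiv_clm_apply hfd (differentiableAt_const _)]
    simp [hb]
  let M : Matrix (Fin m) (Fin m) ℝ := Matrix.of fun i j =>
    b (EuclideanSpace.single i 1) (EuclideanSpace.single j 1)
  have hquad : ∀ v : EuclideanSpace ℝ (Fin m), b v v = v.ofLp ⬝ᵥ M *ᵥ v.ofLp := by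
    intro v
    have hv : v = ∑ i, v i • EuclideanSpace.single i (1 : ℝ) := by
      simpa using ((EuclideanSpace.basisFun (Fin m) ℝ).sum_repr v).symm
    conv_lhs => rw [hv]
    simp only [map_sum, map_smul, _root_.sum_apply, _root_.smul_apply,
      dotProduct, Matrix.mulVec, M, Matrix.of_apply, smul_eq_mul, Finset.mul_sum]
    rw [Finset.sum_comm]
    refine Finset.sum_congr rfl fun i _ => Finset.sum_congr rfl fun j _ => ?_
    ring
  refine ⟨M, Matrix.PosDef.of_dotProduct_mulVec_pos ?_ ?_, ?_, hquad⟩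
  · ext i j
    have := hC2.contDiffAt.isSymmSndFDerivAt (x := 0) (by simp)
    simpa [M] using this (EuclideanSpace.single j 1) (EuclideanSpace.single i 1)
  · intro x hx
    have := fderiv_fderiv_pos hC2 h0 hd0 hc hlb (v := WithLp.toLp 2 x) (by simpa using hx)
    rw [← hb, hquad] at this
    simpa using this
  · simp only [hessDet, M, hentry]

theorem integrable_one_add_const_mul_sq_norm_rpow_neg {E : Type*} [NormedAddCommGroup E]
    [NormedSpace ℝ E] [FiniteDimensional ℝ E] [MeasurableSpace E] [BorelSpace E] (μ : Measure E)
    [μ.IsAddHaarMeasure] {c q : ℝ} (hc : 0 < c) (hq : (Module.finrank ℝ E : ℝ) / 2 < q) :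
    Integrable (fun v : E => (1 + c * ‖v‖ ^ 2) ^ (-q)) μ := by
  have h1 : Integrable (fun v : E => (1 + ‖v‖ ^ 2) ^ (-(2 * q) / 2)) μ :=
    integrable_rpow_neg_one_add_norm_sq (by linarith)
  have hc' : √c ≠ 0 := (sqrt_pos.2 hc).ne'
  refine (h1.comp_smul hc').congr (ae_of_all _ fun v => ?_)
  simp only [norm_smul, mul_pow, norm_of_nonneg (sqrt_nonneg c), sq_sqrt hc.le]
  ring_nf

theorem rpow_mul_setIntegral_eq_integral_rescaled {E : Type*} [NormedAddCommGroup E]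
    [NormedSpace ℝ E] [FiniteDimensional ℝ E] [MeasurableSpace E] [BorelSpace E] (μ : Measure E)
    [μ.IsAddHaarMeasure] {h : E → ℝ} {r : ℝ} (hnn : ∀ y ∈ Metric.ball (0 : E) r, 0 ≤ h y) (q : ℝ)
    {s : ℝ} (hs : 0 < s) :
    (s ^ 2) ^ (q - (Module.finrank ℝ E : ℝ) / 2) *
        ∫ y in Metric.ball (0 : E) r, (s ^ 2 + h y) ^ (-q) ∂μ =
      ∫ v, (Metric.ball (0 : E) r).indicator (fun y => (1 + h y / s ^ 2) ^ (-q)) (s • v) ∂μ := by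
  have hs2 : 0 < s ^ 2 := by positivity
  rw [Measure.integral_comp_smul, integral_indicator Metric.isOpen_ball.measurableSet, smul_eq_mul,
    abs_of_pos (by positivity)]
  have hpt : ∀ y ∈ Metric.ball (0 : E) r,
      (s ^ 2 + h y) ^ (-q) = (s ^ 2) ^ (-q) * (1 + h y / s ^ 2) ^ (-q) := by
    intro y hy
    have := hnn y hy
    rw [← mul_rpow hs2.le (by positivity)]
    congr 1
    field_simp
  rw [setIntegral_congr_fun Metric.isOpen_ball.measurableSet hpt, integral_const_mul, ← mul_assoc,
    ← rpow_add hs2]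
  congr 1
  rw [← rpow_natCast s 2, ← rpow_mul hs.le, ← rpow_natCast, ← rpow_neg hs.le]
  congr 1
  push_cast
  ring

theorem tendsto_rpow_mul_setIntegral_rpow_neg {m : ℕ} {h : EuclideanSpace ℝ (Fin m) → ℝ}
    (hC2 : ContDiff ℝ 2 h) (h0 : h 0 = 0) (hd0 : fderiv ℝ h 0 = 0) {c : ℝ} (hc : 0 < c)
    (hlb : ∀ y : EuclideanSpace ℝ (Fin m), 0 < ‖y‖ → ‖y‖ < 1 → c * ‖y‖ ^ 2 ≤ h y)
    {q r : ℝ} (hq : (m : ℝ) / 2 < q) (hr : 0 < r) (hr1 : r < 1) :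
    Tendsto (fun ε : ℝ => ε ^ (q - (m : ℝ) / 2) *
        ∫ y in Metric.ball (0 : EuclideanSpace ℝ (Fin m)) r, (ε + h y) ^ (-q)) (𝓝[>] 0)
      (𝓝 ((2 * π) ^ ((m : ℝ) / 2) * Gamma (q - (m : ℝ) / 2) / (√(hessDet h) * Gamma q))) := by
  obtain ⟨M, hM, hMdet, hMquad⟩ := exists_posDef_hessian hC2 h0 hd0 hc hlb
  have hq0 : 0 < q := lt_of_le_of_lt (by positivity) hq
  have hlow : ∀ y ∈ Metric.ball (0 : EuclideanSpace ℝ (Fin m)) r, c * ‖y‖ ^ 2 ≤ h y := by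
    intro y hy
    rcases eq_or_ne y 0 with rfl | hy0
    · simp [h0]
    · exact hlb y (norm_pos_iff.2 hy0) ((mem_ball_zero_iff.1 hy).trans hr1)
  have hnn : ∀ y ∈ Metric.ball (0 : EuclideanSpace ℝ (Fin m)) r, 0 ≤ h y := fun y hy =>
    le_trans (by positivity) (hlow y hy)
  rw [← hMdet, ← integral_one_add_quadratic_rpow_neg hM hq]
  simp_rw [← hMquad]
  have hlim : Tendsto (fun s : ℝ => ∫ v, (Metric.ball (0 : EuclideanSpace ℝ (Fin m)) r).indicator
      (fun y => (1 + h y / s ^ 2) ^ (-q)) (s • v)) (𝓝[>] 0)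
      (𝓝 (∫ v : EuclideanSpace ℝ (Fin m), (1 + fderiv ℝ (fderiv ℝ h) 0 v v / 2) ^ (-q))) := by
    refine tendsto_integral_filter_of_dominated_convergence
      (fun v => (1 + c * ‖v‖ ^ 2) ^ (-q)) ?_ ?_ ?_ ?_
    · refine Eventually.of_forall fun s => Measurable.aestronglyMeasurable ?_
      have : Measurable fun y : EuclideanSpace ℝ (Fin m) => (1 + h y / s ^ 2) ^ (-q) :=
        ((hC2.continuous.measurable.div_const _).const_add 1).pow_const _
      exact (this.indicator Metric.isOpen_ball.measurableSet).comp (measurable_const_smul s)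
    · filter_upwards [self_mem_nhdsWithin] with s hs
      have hs : 0 < s := hs
      refine ae_of_all _ fun v => ?_
      by_cases hv : s • v ∈ Metric.ball (0 : EuclideanSpace ℝ (Fin m)) r
      · have h1 : c * ‖v‖ ^ 2 ≤ h (s • v) / s ^ 2 := by
          rw [le_div_iff₀ (by positivity)]
          have := hlow _ hv
          rw [norm_smul, norm_of_nonneg hs.le] at this
          linarith
        have h2 : 0 ≤ c * ‖v‖ ^ 2 := by positivity
        rw [Set.indicator_of_mem hv, norm_of_nonneg (rpow_nonneg (by linarith) _)]
        exact rpow_le_rpow_of_nonpos (by linarith) (by linarith) (by linarith)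
      · rw [Set.indicator_of_notMem hv, norm_zero]
        positivity
    · exact integrable_one_add_const_mul_sq_norm_rpow_neg volume hc (by simpa using hq)
    · refine ae_of_all _ fun v => ?_
      have hpos : 0 < 1 + fderiv ℝ (fderiv ℝ h) 0 v v / 2 := by
        rcases eq_or_ne v 0 with rfl | hv
        · simp
        · have := fderiv_fderiv_pos hC2 h0 hd0 hc hlb hv
          positivity
      have h1 := ((tendsto_div_sq_of_contDiff_two hC2 h0 hd0 v).const_add 1).rpow_const
        (p := -q) (Or.inl hpos.ne')
      refine h1.congr' ?_
      have h2 : Tendsto (fun s : ℝ => s • v) (𝓝[>] 0) (𝓝 0) := by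
        have hcont : Continuous fun s : ℝ => s • v := by fun_prop
        have := hcont.tendsto 0
        rw [zero_smul] at this
        exact this.mono_left nhdsWithin_le_nhds
      filter_upwards [h2.eventually_mem (Metric.ball_mem_nhds 0 hr)] with s hs
      rw [Set.indicator_of_mem hs]
  have hsqrt : Tendsto (fun ε : ℝ => √ε) (𝓝[>] 0) (𝓝[>] 0) := by
    refine tendsto_nhdsWithin_iff.2 ⟨?_, ?_⟩
    · have := continuous_sqrt.tendsto 0
      rw [sqrt_zero] at this
      exact this.mono_left nhdsWithin_le_nhds
    · filter_upwards [self_mem_nhdsWithin] with ε hε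
      exact sqrt_pos.2 hε
  refine (hlim.comp hsqrt).congr' ?_
  filter_upwards [self_mem_nhdsWithin] with ε hε
  have hε : 0 < ε := hε
  have := rpow_mul_setIntegral_eq_integral_rescaled volume hnn q (sqrt_pos.2 hε)
  rw [sq_sqrt hε.le, finrank_euclideanSpace_fin] at this
  simp only [Function.comp_apply, sq_sqrt hε.le, this]

theorem hasDerivAt_setIntegral_add_rpow_neg {α : Type*} [MeasurableSpace α] {μ : Measure α}
    {s : Set α} (hs : MeasurableSet s) (hμs : μ s ≠ ⊤) {h : α → ℝ} (hmeas : Measurable h)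
    (hnn : ∀ y ∈ s, 0 ≤ h y) {q : ℝ} (hq : 0 ≤ q) {ε : ℝ} (hε : 0 < ε) :
    HasDerivAt (fun x : ℝ => ∫ y in s, (x + h y) ^ (-q) ∂μ)
      (-q * ∫ y in s, (ε + h y) ^ (-(q + 1)) ∂μ) ε := by
  have : IsFiniteMeasure (μ.restrict s) := ⟨by simpa using hμs.lt_top⟩
  rw [← integral_const_mul]
  refine (hasDerivAt_integral_of_dominated_loc_of_deriv_le
    (F' := fun x y => -q * (x + h y) ^ (-(q + 1))) (s := Set.Ioi (ε / 2))
    (bound := fun _ => q * (ε / 2) ^ (-(q + 1)))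
    (Ioi_mem_nhds (by linarith)) ?_ ?_ ?_ ?_ (integrable_const _) ?_).2
  · exact Eventually.of_forall fun x => ((hmeas.const_add x).pow_const _).aestronglyMeasurable
  · refine Integrable.of_bound ((hmeas.const_add ε).pow_const _).aestronglyMeasurable (ε ^ (-q)) ?_
    filter_upwards [ae_restrict_mem hs] with y hy
    have := hnn y hy
    rw [norm_of_nonneg (by positivity)]
    exact rpow_le_rpow_of_nonpos hε (by linarith) (by linarith)
  · exact (((hmeas.const_add ε).pow_const _).const_mul _).aestronglyMeasurable
  · filter_upwards [ae_restrict_mem hs] with y hy x hx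
    have hx : ε / 2 < x := hx
    have h1 := hnn y hy
    have h2 : 0 < x := by linarith
    rw [norm_mul, norm_neg, norm_of_nonneg hq, norm_of_nonneg (by positivity)]
    exact mul_le_mul_of_nonneg_left
      (rpow_le_rpow_of_nonpos (by linarith) (by linarith) (by linarith)) hq
  · filter_upwards [ae_restrict_mem hs] with y hy x hx
    have hx : ε / 2 < x := hx
    have h1 := hnn y hy
    have h2 := ((hasDerivAt_id x).add_const (h y)).rpow_const (p := -q)
      (Or.inl (by simp only [id]; linarith))
    refine h2.congr_deriv ?_
    simp only [id]
    rw [show -q - 1 = -(q + 1) by ring]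
    ring

theorem tendsto_div_self_of_tendsto_deriv {G G' : ℝ → ℝ} {L : ℝ}
    (hG : ∀ t, HasDerivAt G (G' t) t) (hlim : Tendsto G' atTop (𝓝 L)) :
    Tendsto (fun t => G t / t) atTop (𝓝 L) := by
  rw [Metric.tendsto_nhds]
  intro δ hδ
  obtain ⟨T, hT⟩ := eventually_atTop.1 (Metric.tendsto_nhds.1 hlim (δ / 2) (by positivity))
  let H : ℝ → ℝ := fun t => G t - L * t
  have hH : ∀ t, HasDerivAt H (G' t - L) t := fun t => by
    simpa using (hG t).fun_sub ((hasDerivAt_id t).const_mul L)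
  have hdecay : Tendsto (fun t : ℝ => (|H T| + δ / 2 * |T|) / t) atTop (𝓝 0) :=
    tendsto_const_nhds.div_atTop tendsto_id
  filter_upwards [hdecay.eventually (gt_mem_nhds (half_pos hδ)), eventually_gt_atTop 0,
    eventually_ge_atTop T] with t ht ht0 htT
  have hmv : ‖H t - H T‖ ≤ δ / 2 * ‖t - T‖ :=
    (convex_Ici T).norm_image_sub_le_of_norm_hasDerivWithin_le
      (fun x _ => (hH x).hasDerivWithinAt)
      (fun x hx => by
        have := hT x hx
        rw [Real.dist_eq] at this
        exact this.le) Set.self_mem_Ici htT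
  rw [div_lt_iff₀ ht0] at ht
  have h1 : G t / t - L = H t / t := by
    simp only [H]
    field_simp
  rw [Real.dist_eq, h1, abs_div, abs_of_pos ht0, div_lt_iff₀ ht0]
  simp only [norm_eq_abs] at hmv
  rw [abs_of_nonneg (sub_nonneg.2 htT)] at hmv
  have h2 : |H t| ≤ |H t - H T| + |H T| := by
    simpa using abs_add_le (H t - H T) (H T)
  nlinarith [neg_abs_le T]

theorem tendsto_div_abs_log_of_tendsto_mul_deriv {F F' : ℝ → ℝ} {L : ℝ}
    (hF : ∀ ε, 0 < ε → HasDerivAt F (F' ε) ε)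
    (hlim : Tendsto (fun ε => ε * F' ε) (𝓝[>] 0) (𝓝 (-L))) :
    Tendsto (fun ε => F ε / |log ε|) (𝓝[>] 0) (𝓝 L) := by
  have hexp : Tendsto (fun t : ℝ => exp (-t)) atTop (𝓝[>] 0) :=
    tendsto_nhdsWithin_iff.2
      ⟨tendsto_exp_neg_atTop_nhds_zero, Eventually.of_forall fun t => exp_pos _⟩
  have hG : ∀ t, HasDerivAt (fun t => F (exp (-t))) (-(exp (-t) * F' (exp (-t)))) t := by
    intro t
    have := (hF _ (exp_pos (-t))).comp t (hasDerivAt_neg t).exp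
    refine this.congr_deriv ?_
    ring
  have h1 := tendsto_div_self_of_tendsto_deriv hG (by simpa using (hlim.comp hexp).neg)
  refine (h1.comp (tendsto_neg_atBot_atTop.comp tendsto_log_nhdsGT_zero)).congr' ?_
  filter_upwards [Ioo_mem_nhdsGT one_pos] with ε hε
  simp only [Function.comp_apply, neg_neg]
  rw [exp_log hε.1, abs_of_neg (log_neg hε.1 hε.2)]

theorem tendsto_setIntegral_rpow_neg_div_abs_log {m : ℕ} (hm : 0 < m)
    {h : EuclideanSpace ℝ (Fin m) → ℝ}
    (hC2 : ContDiff ℝ 2 h) (h0 : h 0 = 0) (hd0 : fderiv ℝ h 0 = 0) {c : ℝ} (hc : 0 < c)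
    (hlb : ∀ y : EuclideanSpace ℝ (Fin m), 0 < ‖y‖ → ‖y‖ < 1 → c * ‖y‖ ^ 2 ≤ h y)
    {r : ℝ} (hr : 0 < r) (hr1 : r < 1) :
    Tendsto (fun ε : ℝ =>
        (∫ y in Metric.ball (0 : EuclideanSpace ℝ (Fin m)) r, (ε + h y) ^ (-((m : ℝ) / 2))) / |log ε|)
      (𝓝[>] 0)
      (𝓝 ((2 * π) ^ ((m : ℝ) / 2) / (√(hessDet h) * Gamma ((m : ℝ) / 2)))) := by
  have hm2 : 0 < (m : ℝ) / 2 := by positivity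
  have hnn : ∀ y ∈ Metric.ball (0 : EuclideanSpace ℝ (Fin m)) r, 0 ≤ h y := by
    intro y hy
    rcases eq_or_ne y 0 with rfl | hy0
    · exact h0.ge
    · exact le_trans (by positivity)
        (hlb y (norm_pos_iff.2 hy0) ((mem_ball_zero_iff.1 hy).trans hr1))
  refine tendsto_div_abs_log_of_tendsto_mul_deriv
    (fun ε hε => hasDerivAt_setIntegral_add_rpow_neg Metric.isOpen_ball.measurableSet
      measure_ball_lt_top.ne hC2.continuous.measurable hnn hm2.le hε) ?_
  have h1 := (tendsto_rpow_mul_setIntegral_rpow_neg hC2 h0 hd0 hc hlb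
    (lt_add_one ((m : ℝ) / 2)) hr hr1).const_mul (-((m : ℝ) / 2))
  simp only [add_sub_cancel_left, rpow_one, Gamma_one, Gamma_add_one hm2.ne'] at h1
  convert h1 using 2
  · exact mul_left_comm _ _ _
  · field_simp

theorem setIntegral_div_rpow_eq {α : Type*} [MeasurableSpace α] {μ : Measure α} {s : Set α}
    (hs : MeasurableSet s) {h : α → ℝ} (hnn : ∀ y ∈ s, 0 ≤ h y) (q : ℝ) {θ ε : ℝ} (hθ : 0 ≤ θ)
    (hε : 0 ≤ ε) :
    ∫ y in s, (θ / (ε + h y)) ^ q ∂μ = θ ^ q * ∫ y in s, (ε + h y) ^ (-q) ∂μ := by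
  rw [← integral_const_mul]
  refine setIntegral_congr_fun hs fun y hy => ?_
  have : 0 ≤ ε + h y := add_nonneg hε (hnn y hy)
  rw [div_rpow hθ this, rpow_neg this, div_eq_mul_inv]

theorem tendsto_setIntegral_Theta_div_rpow {n : ℕ} (hn : 2 ≤ n) {p c : ℝ}
    (hp : ((n : ℝ) + 1) / 2 ≤ p) (hc : 0 < c)
    {h : EuclideanSpace ℝ (Fin (n - 1)) → ℝ} (hC2 : ContDiff ℝ 2 h)
    (h0 : h 0 = 0) (hd0 : fderiv ℝ h 0 = 0)
    (hlb : ∀ y : EuclideanSpace ℝ (Fin (n - 1)), 0 < ‖y‖ → ‖y‖ < 1 → c * ‖y‖ ^ 2 ≤ h y)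
    {r : ℝ} (hr : 0 < r) (hr1 : r < 1) :
    Tendsto (fun ε => ∫ y in Metric.ball (0 : EuclideanSpace ℝ (Fin (n - 1))) r,
        (Theta n p ε / (ε + h y)) ^ (p - 1)) (𝓝[>] 0) (𝓝 (1 / Kconst n p h)) := by
  have hcast : ((n - 1 : ℕ) : ℝ) = (n : ℝ) - 1 := by
    rw [Nat.cast_sub (by omega), Nat.cast_one]
  have hn2 : (2 : ℝ) ≤ n := by exact_mod_cast hn
  have hp1 : 0 < p - 1 := by linarith
  have hnn : ∀ y ∈ Metric.ball (0 : EuclideanSpace ℝ (Fin (n - 1))) r, 0 ≤ h y := by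
    intro y hy
    rcases eq_or_ne y 0 with rfl | hy0
    · exact h0.ge
    · exact le_trans (by positivity)
        (hlb y (norm_pos_iff.2 hy0) ((mem_ball_zero_iff.1 hy).trans hr1))
  have hΘ : ∀ ε, 0 < ε → 0 ≤ Theta n p ε := fun ε hε => by
    unfold Theta
    split_ifs <;> positivity
  rcases hp.lt_or_eq with hlt | heq
  · have hlim := tendsto_rpow_mul_setIntegral_rpow_neg hC2 h0 hd0 hc hlb (q := p - 1)
      (by rw [hcast]; linarith) hr hr1
    have hK : 1 / Kconst n p h = (2 * π) ^ (((n - 1 : ℕ) : ℝ) / 2) *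
        Gamma (p - 1 - ((n - 1 : ℕ) : ℝ) / 2) / (√(hessDet h) * Gamma (p - 1)) := by
      rw [Kconst, if_pos hlt, one_div_div, hcast,
        show p - 1 - ((n : ℝ) - 1) / 2 = p - ((n : ℝ) + 1) / 2 by ring]
    rw [hK]
    refine hlim.congr' ?_
    filter_upwards [self_mem_nhdsWithin] with ε hε
    have hε : 0 < ε := hε
    rw [setIntegral_div_rpow_eq Metric.isOpen_ball.measurableSet hnn _ (hΘ ε hε) hε.le, Theta,
      if_pos hlt, ← rpow_mul hε.le, hcast]
    congr 2
    field_simp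
    ring
  · have hlim := tendsto_setIntegral_rpow_neg_div_abs_log (by omega) hC2 h0 hd0 hc hlb hr hr1
    have hK : 1 / Kconst n p h = (2 * π) ^ (((n - 1 : ℕ) : ℝ) / 2) /
        (√(hessDet h) * Gamma (((n - 1 : ℕ) : ℝ) / 2)) := by
      rw [Kconst, if_neg heq.not_lt, one_div_div, hcast]
    rw [hK]
    refine hlim.congr' ?_
    filter_upwards [self_mem_nhdsWithin] with ε hε
    have hε : 0 < ε := hε
    have hpm : p - 1 = ((n - 1 : ℕ) : ℝ) / 2 := by
      rw [hcast, ← heq]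
      ring
    rw [setIntegral_div_rpow_eq Metric.isOpen_ball.measurableSet hnn _ (hΘ ε hε) hε.le, Theta,
      if_neg heq.not_lt, ← rpow_mul (abs_nonneg _), neg_mul, one_div_mul_cancel hp1.ne',
      rpow_neg_one, hpm, div_eq_inv_mul]

theorem statement17 (n : ℕ) (hn : 2 ≤ n) (p c₁ : ℝ)
    (hp : ((n : ℝ) + 1) / 2 ≤ p) (hc₁ : 0 < c₁)
    (h : EuclideanSpace ℝ (Fin (n - 1)) → ℝ) (hC2 : ContDiff ℝ 2 h)
    (h0 : h 0 = 0) (hd0 : fderiv ℝ h 0 = 0)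
    (hlb : ∀ y : EuclideanSpace ℝ (Fin (n - 1)), 0 < ‖y‖ → ‖y‖ < 1 → c₁ * ‖y‖ ^ 2 ≤ h y) :
    ∀ η : ℝ, 0 < η → ∃ r₀ ∈ Set.Ioo (0 : ℝ) 1, ∀ r ∈ Set.Ioo (0 : ℝ) r₀,
      ∃ ε₀ : ℝ, 0 < ε₀ ∧ ∀ ε ∈ Set.Ioo (0 : ℝ) ε₀,
        |(∫ y in Metric.ball (0 : EuclideanSpace ℝ (Fin (n - 1))) r,
            (Theta n p ε / (ε + h y)) ^ (p - 1)) - 1 / Kconst n p h| < η := by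
  intro η hη
  refine ⟨1 / 2, by norm_num, fun r hr => ?_⟩
  have hlim := tendsto_setIntegral_Theta_div_rpow hn hp hc₁ hC2 h0 hd0 hlb hr.1
    (by linarith [hr.2])
  obtain ⟨ε₀, hε₀, hsub⟩ := mem_nhdsGT_iff_exists_Ioo_subset.1 (Metric.tendsto_nhds.1 hlim η hη)
  exact ⟨ε₀, hε₀, fun ε hε => hsub hε⟩

end
end
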